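/- arXiv:2105.08753 — 4 statements merged into one kernel-verified Lean document; each statement's English description precedes it below -/
import Mathlib

section
/- Let Φ be the cumulative distribution function of gaussianReal 0 1, let τ ∈ ℝ, and let Q : ℝ → ℝ be any function satisfying Φ(Q(y)) = y for every y ∈ (0,1). Then the pushforward, under the map u ↦ Q(Φ(τ) + u·(1 − Φ(τ))), of the uniform probability measure on the interval (0,1) equals the conditional distribution of gaussianReal 0 1 given the event [τ, ∞); that is, it equals the measure A ↦ (gaussianReal 0 1)(A ∩ [τ,∞)) / (gaussianReal 0 1)([τ,∞)). -/
open MeasureTheory ProbabilityTheory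

theorem strictMono_cdf_of_isOpenPosMeasure (μ : Measure ℝ) [IsProbabilityMeasure μ]
    [μ.IsOpenPosMeasure] : StrictMono (cdf μ) := by
  intro a b hab
  have h : 0 < μ (Set.Ioc a b) :=
    (Measure.measure_Ioo_pos μ |>.2 hab).trans_le (measure_mono Set.Ioo_subset_Ioc_self)
  rw [← measure_cdf μ, StieltjesFunction.measure_Ioc, ENNReal.ofReal_pos] at h
  linarith

/-- Inverse transform sampling of an atomless probability measure with strictly increasing cdf,
conditioned on `[τ, ∞)`. -/
theorem map_quantile_eq_cond_Ici (μ : Measure ℝ) [IsProbabilityMeasure μ] [NullSingletonClass μ]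
    (hμ : StrictMono (cdf μ)) (τ : ℝ) (Q : ℝ → ℝ)
    (hQ : ∀ y ∈ Set.Ioo (0 : ℝ) 1, cdf μ (Q y) = y) :
    (volume.restrict (Set.Ioo (0 : ℝ) 1)).map (fun u => Q (cdf μ τ + u * (1 - cdf μ τ))) =
      (μ (Set.Ici τ))⁻¹ • μ.restrict (Set.Ici τ) := by
  have hlt (x : ℝ) : cdf μ x < 1 := (hμ (lt_add_one x)).trans_le (cdf_le_one μ _)
  have hp : 0 < 1 - cdf μ τ := sub_pos.2 (hlt τ)
  have hmem : ∀ u ∈ Set.Ioo (0 : ℝ) 1, cdf μ τ + u * (1 - cdf μ τ) ∈ Set.Ioo (0 : ℝ) 1 := by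
    intro u hu
    have h0 := cdf_nonneg μ τ
    constructor
    · have := mul_pos hu.1 hp
      linarith
    · nlinarith [hu.2]
  have hle : ∀ u ∈ Set.Ioo (0 : ℝ) 1, ∀ x, Q (cdf μ τ + u * (1 - cdf μ τ)) ≤ x ↔
      u ≤ (cdf μ x - cdf μ τ) / (1 - cdf μ τ) := by
    intro u hu x
    rw [← hμ.le_iff_le, hQ _ (hmem u hu), le_div_iff₀ hp, le_sub_iff_add_le']
  have hmeas : AEMeasurable (fun u => Q (cdf μ τ + u * (1 - cdf μ τ)))
      (volume.restrict (Set.Ioo (0 : ℝ) 1)) := by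
    refine aemeasurable_restrict_of_monotoneOn measurableSet_Ioo fun u hu v hv huv => ?_
    rw [hle u hu]
    exact huv.trans ((hle v hv _).1 le_rfl)
  have hIci : μ (Set.Ici τ) = ENNReal.ofReal (1 - cdf μ τ) := by
    rw [← measure_congr Ioi_ae_eq_Ici]
    conv_lhs => rw [← measure_cdf μ]
    rw [StieltjesFunction.measure_Ioi _ (tendsto_cdf_atTop μ)]
  refine Measure.ext_of_Iic _ _ fun x => ?_
  have hset : (fun u => Q (cdf μ τ + u * (1 - cdf μ τ))) ⁻¹' Set.Iic x ∩ Set.Ioo 0 1 =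
      Set.Ioc 0 ((cdf μ x - cdf μ τ) / (1 - cdf μ τ)) := by
    have hc : (cdf μ x - cdf μ τ) / (1 - cdf μ τ) < 1 := by
      rw [div_lt_one hp]
      linarith [hlt x]
    ext u
    constructor
    · rintro ⟨h, hu⟩
      exact ⟨hu.1, (hle u hu x).1 h⟩
    · rintro ⟨h0, h⟩
      have hu : u ∈ Set.Ioo (0 : ℝ) 1 := ⟨h0, h.trans_lt hc⟩
      exact ⟨(hle u hu x).2 h, hu⟩
  have hIcc : μ (Set.Icc τ x) = ENNReal.ofReal (cdf μ x - cdf μ τ) := by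
    rw [← measure_congr Ioc_ae_eq_Icc]
    conv_lhs => rw [← measure_cdf μ]
    rw [StieltjesFunction.measure_Ioc]
  rw [Measure.map_apply_of_aemeasurable hmeas measurableSet_Iic,
    Measure.restrict_apply' measurableSet_Ioo, hset, Real.volume_Ioc, sub_zero,
    Measure.smul_apply, Measure.restrict_apply measurableSet_Iic, Set.inter_comm,
    Set.Ici_inter_Iic, hIcc, hIci, smul_eq_mul, ENNReal.ofReal_div_of_pos hp,
    ENNReal.div_eq_inv_mul]

/-- Inverse transform sampling of a standard Gaussian conditioned on `[τ, ∞)`: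
if `Q` is an inverse on `(0,1)` of the standard Gaussian cdf `Φ`, then the pushforward of the
uniform distribution on `(0,1)` under `u ↦ Q(Φ(τ) + u (1 - Φ(τ)))` is the conditional
distribution of `gaussianReal 0 1` given `[τ, ∞)`, i.e. the measure
`A ↦ (gaussianReal 0 1)(A ∩ [τ,∞)) / (gaussianReal 0 1)([τ,∞))`. -/
theorem inverse_transform_truncated_gaussian (τ : ℝ) (Q : ℝ → ℝ)
    (hQ : ∀ y ∈ Set.Ioo (0 : ℝ) 1, cdf (gaussianReal 0 1) (Q y) = y) :
    (volume.restrict (Set.Ioo (0 : ℝ) 1)).map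
        (fun u => Q (cdf (gaussianReal 0 1) τ + u * (1 - cdf (gaussianReal 0 1) τ))) =
      ((gaussianReal 0 1) (Set.Ici τ))⁻¹ • (gaussianReal 0 1).restrict (Set.Ici τ) := by
  have : NullSingletonClass (gaussianReal 0 1) := nullSingletonClass_gaussianReal one_ne_zero
  have : (gaussianReal 0 1).IsOpenPosMeasure :=
    (gaussianReal_absolutelyContinuous' 0 one_ne_zero).isOpenPosMeasure
  exact map_quantile_eq_cond_Ici _ (strictMono_cdf_of_isOpenPosMeasure _) τ Q hQ
end

section
/- Let (α, ν) be a σ-finite measure space, let g : α → [0,∞) be measurable, and let υ_1, …, υ_J : α → [0,∞) be measurable functions such that for every a ∈ α with g(a) > 0 there exists i with υ_i(a) > 0. Let O = {x ∈ ℝ^J : x_i > 0 for all i} and assume that for every x ∈ O the function a ↦ g(a)/(∑_{i=1}^J x_i υ_i(a)) is integrable with respect to ν. Then the function V(x) = ∫ g(a)/(∑_{i=1}^J x_i υ_i(a)) dν(a) is convex on O. -/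
open MeasureTheory

/-- The reciprocal is convex on the positive reals. -/
lemma inv_convex_combination_le {a b u v : ℝ} (ha : 0 ≤ a) (hb : 0 ≤ b) (hab : a + b = 1)
    (hu : 0 < u) (hv : 0 < v) : (a * u + b * v)⁻¹ ≤ a * u⁻¹ + b * v⁻¹ := by
  simpa only [zpow_neg_one, smul_eq_mul] using
    (convexOn_zpow (𝕜 := ℝ) (-1)).2 (Set.mem_Ioi.2 hu) (Set.mem_Ioi.2 hv) ha hb hab

/-- A positive combination of nonnegative numbers, one of which is positive, is positive. -/
lemma sum_mul_pos_of_exists_pos {ι : Type*} [Fintype ι] {x w : ι → ℝ} (hx : ∀ i, 0 < x i)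
    (hw : ∀ i, 0 ≤ w i) (h : ∃ i, 0 < w i) : 0 < ∑ i, x i * w i := by
  obtain ⟨i, hi⟩ := h
  exact Finset.sum_pos' (fun j _ => mul_nonneg (hx j).le (hw j))
    ⟨i, Finset.mem_univ i, mul_pos (hx i) hi⟩

/-- The set of vectors with positive coordinates is convex. -/
lemma convex_setOf_forall_pos (ι : Type*) : Convex ℝ {x : ι → ℝ | ∀ i, 0 < x i} := by
  intro x hx y hy a b ha hb hab i
  exact convex_Ioi (0 : ℝ) (hx i) (hy i) ha hb hab

/-- Convexity of the importance-sampling variance in the mixture weights (Theorem 1, convexity):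
the function `V(x) = ∫ g(a) / (∑ i, x i * υ i a) dν(a)` is convex on the open positive
orthant, provided the integrand is integrable there and the denominator is positive wherever
`g` is positive. -/
theorem convexOn_importance_variance {α : Type*} [MeasurableSpace α] (ν : Measure α)
    [SigmaFinite ν] (J : ℕ) (g : α → ℝ) (hgm : Measurable g) (hg0 : ∀ a, 0 ≤ g a)
    (υ : Fin J → α → ℝ) (hυm : ∀ i, Measurable (υ i)) (hυ0 : ∀ i a, 0 ≤ υ i a)
    (hpos : ∀ a, 0 < g a → ∃ i, 0 < υ i a)
    (hint : ∀ x : Fin J → ℝ, (∀ i, 0 < x i) →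
      Integrable (fun a => g a / ∑ i, x i * υ i a) ν) :
    ConvexOn ℝ {x : Fin J → ℝ | ∀ i, 0 < x i}
      (fun x => ∫ a, g a / ∑ i, x i * υ i a ∂ν) := by
  refine ⟨convex_setOf_forall_pos _, ?_⟩
  intro x hx y hy a b ha hb hab
  have hz := convex_setOf_forall_pos _ hx hy ha hb hab
  simp only [smul_eq_mul]
  rw [← integral_const_mul, ← integral_const_mul,
    ← integral_add ((hint x hx).const_mul a) ((hint y hy).const_mul b)]
  refine integral_mono (hint _ hz)
    (((hint x hx).const_mul a).add ((hint y hy).const_mul b)) fun p => ?_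
  rcases (hg0 p).eq_or_lt with hg | hg
  · simp [← hg]
  · have hsum : ∑ i, (a • x + b • y) i * υ i p
        = a * ∑ i, x i * υ i p + b * ∑ i, y i * υ i p := by
      rw [Finset.mul_sum, Finset.mul_sum, ← Finset.sum_add_distrib]
      refine Finset.sum_congr rfl fun i _ => ?_
      simp only [Pi.add_apply, Pi.smul_apply, smul_eq_mul]
      ring
    have hinv := inv_convex_combination_le ha hb hab
      (sum_mul_pos_of_exists_pos hx (fun i => hυ0 i p) (hpos p hg))
      (sum_mul_pos_of_exists_pos hy (fun i => hυ0 i p) (hpos p hg))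
    have hmul := mul_le_mul_of_nonneg_left hinv hg.le
    simp only [hsum, div_eq_mul_inv]
    linarith
end

section
/- Let (α, ν) be a σ-finite measure space, let g : α → [0,∞) be measurable, and let υ_1, …, υ_J : α → [0,∞) be measurable functions such that for every a ∈ α with g(a) > 0 there exists i with υ_i(a) > 0. Fix x ∈ ℝ^J with x_i > 0 for all i, and assume that a ↦ g(a)/(∑_i x_i υ_i(a)) is ν-integrable and that for each j ∈ {1,…,J} the function a ↦ g(a) υ_j(a)/(∑_i x_i υ_i(a))² is ν-integrable. Then the function V(y) = ∫ g(a)/(∑_i y_i υ_i(a)) dν(a), defined on the open positive orthant, is differentiable at x with partial derivatives ∂V/∂x_j (x) = − ∫ g(a) υ_j(a)/(∑_i x_i υ_i(a))² dν(a). -/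
open MeasureTheory

/-- The Fréchet derivative of `y ↦ c / ∑ i, y i * w i` where the denominator does not vanish. -/
lemma hasFDerivAt_const_div_sum_mul {ι : Type*} [Fintype ι] (c : ℝ) (w y : ι → ℝ)
    (h : c ≠ 0 → ∑ i, y i * w i ≠ 0) :
    HasFDerivAt (fun z : ι → ℝ => c / ∑ i, z i * w i)
      (∑ j, (-(c * w j / (∑ i, y i * w i) ^ 2)) •
        (ContinuousLinearMap.proj j : (ι → ℝ) →L[ℝ] ℝ)) y := by
  rcases eq_or_ne c 0 with rfl | hc
  · simpa using hasFDerivAt_const (0 : ℝ) y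
  have hsum : HasFDerivAt (fun z : ι → ℝ => ∑ i, z i * w i)
      (∑ i, w i • (ContinuousLinearMap.proj i : (ι → ℝ) →L[ℝ] ℝ)) y :=
    HasFDerivAt.fun_sum fun i _ => (hasFDerivAt_apply i y).mul_const (w i)
  have hinv := ((hasDerivAt_inv (h hc)).comp_hasFDerivAt y hsum).const_mul c
  refine (hinv.congr_fderiv ?_).congr_of_eventuallyEq (.of_forall fun z => div_eq_mul_inv _ _)
  simp only [Finset.smul_sum, smul_smul]
  refine Finset.sum_congr rfl fun j _ => ?_
  congr 1
  ring

lemma sum_mul_pos {ι : Type*} [Fintype ι] {y w : ι → ℝ} (hy : ∀ i, 0 < y i)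
    (hw : ∀ i, 0 ≤ w i) (h : ∃ i, 0 < w i) : 0 < ∑ i, y i * w i := by
  obtain ⟨i, hi⟩ := h
  exact Finset.sum_pos' (fun k _ => mul_nonneg (hy k).le (hw k))
    ⟨i, Finset.mem_univ i, mul_pos (hy i) hi⟩

/-- On the set where every coordinate exceeds half of that of `x`, the partial derivatives of
`y ↦ c / ∑ i, y i * w i` are at most four times their values at `x`. -/
lemma const_mul_div_sum_mul_sq_le {ι : Type*} [Fintype ι] {c : ℝ} (hc : 0 ≤ c) {w x y : ι → ℝ}
    (hw : ∀ i, 0 ≤ w i) (hpos : 0 < c → ∃ i, 0 < w i) (hx : ∀ i, 0 < x i)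
    (hxy : ∀ i, x i / 2 < y i) (j : ι) :
    c * w j / (∑ i, y i * w i) ^ 2 ≤ 4 * (c * w j / (∑ i, x i * w i) ^ 2) := by
  rcases hc.eq_or_lt with rfl | hc'
  · simp
  have hX := sum_mul_pos hx hw (hpos hc')
  have hle : (∑ i, x i * w i) / 2 ≤ ∑ i, y i * w i := by
    rw [Finset.sum_div]
    refine Finset.sum_le_sum fun i _ => ?_
    have := mul_le_mul_of_nonneg_right (hxy i).le (hw i)
    linarith
  calc c * w j / (∑ i, y i * w i) ^ 2
      ≤ c * w j / ((∑ i, x i * w i) / 2) ^ 2 := by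
        have := mul_nonneg hc (hw j)
        gcongr
    _ = 4 * (c * w j / (∑ i, x i * w i) ^ 2) := by
        field_simp
        norm_num

lemma norm_proj_le_one {ι : Type*} [Fintype ι] (j : ι) :
    ‖(ContinuousLinearMap.proj j : (ι → ℝ) →L[ℝ] ℝ)‖ ≤ 1 :=
  ContinuousLinearMap.opNorm_le_bound _ zero_le_one fun v => by
    simpa using norm_le_pi_norm v j

lemma integrable_sum_smul_const {α ι E : Type*} [MeasurableSpace α] {ν : Measure α} [Fintype ι]
    [NormedAddCommGroup E] [NormedSpace ℝ E] {f : ι → α → ℝ} (hf : ∀ j, Integrable (f j) ν)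
    (c : ι → E) : Integrable (fun a => ∑ j, f j a • c j) ν :=
  integrable_finsetSum _ fun j _ => (hf j).smul_const (c j)

/-- Gradient formula for the importance-sampling variance (Theorem 1, gradient): at any point
`x` of the open positive orthant, `V(y) = ∫ g(a) / (∑ i, y i * υ i a) dν(a)` is differentiable
with partial derivatives `∂V/∂x_j(x) = -∫ g(a) υ j a / (∑ i, x i * υ i a)^2 dν(a)`. -/
theorem hasDeriv_importance_variance {α : Type*} [MeasurableSpace α] (ν : Measure α)
    [SigmaFinite ν] (J : ℕ) (g : α → ℝ) (hgm : Measurable g) (hg0 : ∀ a, 0 ≤ g a)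
    (υ : Fin J → α → ℝ) (hυm : ∀ i, Measurable (υ i)) (hυ0 : ∀ i a, 0 ≤ υ i a)
    (hpos : ∀ a, 0 < g a → ∃ i, 0 < υ i a)
    (x : Fin J → ℝ) (hx : ∀ i, 0 < x i)
    (hint : Integrable (fun a => g a / ∑ i, x i * υ i a) ν)
    (hint' : ∀ j, Integrable (fun a => g a * υ j a / (∑ i, x i * υ i a) ^ 2) ν) :
    DifferentiableAt ℝ (fun y : Fin J → ℝ => ∫ a, g a / ∑ i, y i * υ i a ∂ν) x ∧
      ∀ j, fderiv ℝ (fun y : Fin J → ℝ => ∫ a, g a / ∑ i, y i * υ i a ∂ν) x (Pi.single j 1) =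
        -∫ a, g a * υ j a / (∑ i, x i * υ i a) ^ 2 ∂ν := by
  let P (j : Fin J) : (Fin J → ℝ) →L[ℝ] ℝ := ContinuousLinearMap.proj j
  have hS : {y : Fin J → ℝ | ∀ i, x i / 2 < y i} ∈ nhds x := by
    simp only [Set.ofPred_forall]
    refine Filter.iInter_mem.2 fun i => ?_
    exact (isOpen_lt continuous_const (continuous_apply i)).mem_nhds (half_lt_self (hx i))
  have hF (y : Fin J → ℝ) : AEStronglyMeasurable (fun a => g a / ∑ i, y i * υ i a) ν :=
    Measurable.aestronglyMeasurable (by fun_prop)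
  have hsum : Integrable (fun a => ∑ j, (-(g a * υ j a / (∑ i, x i * υ i a) ^ 2)) • P j) ν :=
    integrable_sum_smul_const (fun j => (hint' j).fun_neg) P
  have hbound : Integrable (fun a => ∑ j, 4 * (g a * υ j a / (∑ i, x i * υ i a) ^ 2)) ν :=
    integrable_finsetSum Finset.univ fun j _ => (hint' j).const_mul 4
  have hV : HasFDerivAt (fun y : Fin J → ℝ => ∫ a, g a / ∑ i, y i * υ i a ∂ν)
      (∫ a, ∑ j, (-(g a * υ j a / (∑ i, x i * υ i a) ^ 2)) • P j ∂ν) x := by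
    refine hasFDerivAt_integral_of_dominated_of_fderiv_le
      (F := fun (y : Fin J → ℝ) a => g a / ∑ i, y i * υ i a)
      (F' := fun (y : Fin J → ℝ) a => ∑ j, (-(g a * υ j a / (∑ i, y i * υ i a) ^ 2)) • P j)
      (bound := fun a => ∑ j, 4 * (g a * υ j a / (∑ i, x i * υ i a) ^ 2))
      hS (.of_forall hF) hint
      hsum.aestronglyMeasurable
      (.of_forall fun a y hy => ?_)
      hbound
      (.of_forall fun a y hy => ?_)
    · refine norm_sum_le_of_le _ fun j _ => ?_
      have hnonneg : 0 ≤ g a * υ j a / (∑ i, y i * υ i a) ^ 2 :=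
        div_nonneg (mul_nonneg (hg0 a) (hυ0 j a)) (sq_nonneg _)
      rw [norm_smul, norm_neg, Real.norm_of_nonneg hnonneg]
      exact (mul_le_of_le_one_right hnonneg (norm_proj_le_one j)).trans
        (const_mul_div_sum_mul_sq_le (hg0 a) (fun i => hυ0 i a) (hpos a) hx hy j)
    · exact hasFDerivAt_const_div_sum_mul (g a) (fun i => υ i a) y fun hga =>
        (sum_mul_pos (fun i => (half_pos (hx i)).trans (hy i)) (fun i => hυ0 i a)
          (hpos a ((hg0 a).lt_of_ne' hga))).ne'
  refine ⟨hV.differentiableAt, fun j => ?_⟩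
  rw [hV.fderiv, ContinuousLinearMap.integral_apply hsum, ← integral_neg]
  simp [P, Pi.single_apply]
end

section
/- Let (α, ν) be a σ-finite measure space, let υ : α → [0,∞) be measurable with ∫ υ dν = 1, and let A_1, …, A_J ⊆ α be measurable sets with union A = ⋃_i A_i and with Π_i = ∫_{A_i} υ dν satisfying 0 < Π_i ≤ 1 for every i. Define υ_i = Π_i^{-1}·υ·1_{A_i} and Π = ∫_A υ dν. Let ε > 0 and let x ∈ ℝ^J satisfy x_i ≥ ε for all i. Then for every j ∈ {1,…,J}, ∫_A υ(a)²·υ_j(a)/(∑_{i=1}^J x_i υ_i(a))² dν(a) ≤ Π/ε². -/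
open MeasureTheory

/-- If `P ≤ 1` and `s` dominates `ε P⁻¹ v`, then `v² (P⁻¹ v) / s² ≤ v / ε²`. -/
lemma sq_mul_inv_mul_div_sq_le {v P ε s : ℝ} (hv : 0 ≤ v) (hP : 0 < P) (hP1 : P ≤ 1)
    (hε : 0 < ε) (hs : ε * (P⁻¹ * v) ≤ s) :
    v ^ 2 * (P⁻¹ * v) / s ^ 2 ≤ v / ε ^ 2 := by
  rcases hv.eq_or_lt with rfl | hv
  · simp
  have hu : 0 < P⁻¹ * v := by positivity
  have hvu : v ≤ P⁻¹ * v := le_mul_of_one_le_left hv.le ((one_le_inv₀ hP).2 hP1)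
  have hs0 : 0 < s := (mul_pos hε hu).trans_le hs
  rw [div_le_div_iff₀ (by positivity) (by positivity)]
  calc v ^ 2 * (P⁻¹ * v) * ε ^ 2 = v * (ε ^ 2 * (v * (P⁻¹ * v))) := by ring
    _ ≤ v * (ε ^ 2 * ((P⁻¹ * v) * (P⁻¹ * v))) := by gcongr
    _ = v * (ε * (P⁻¹ * v)) ^ 2 := by ring
    _ ≤ v * s ^ 2 := by gcongr

/-- Lipschitz-constant estimate for the importance-sampling variance (used in Theorem 5): for
mixture components `υ_i = Π_i⁻¹ υ 1_{A_i}` and mixture weights `x` with `x_i ≥ ε`, each partial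
derivative integral of the variance satisfies
`∫_A υ² υ_j / (∑ i, x i υ_i)² dν ≤ Π / ε²`, where `A = ⋃ i, A_i` and `Π = ∫_A υ dν`. -/
theorem importance_variance_gradient_bound {α : Type*} [MeasurableSpace α] (ν : Measure α)
    [SigmaFinite ν] (J : ℕ) (υ : α → ℝ) (hυm : Measurable υ) (hυ0 : ∀ a, 0 ≤ υ a)
    (hυ1 : ∫ a, υ a ∂ν = 1)
    (A : Fin J → Set α) (hA : ∀ i, MeasurableSet (A i))
    (Pi' : Fin J → ℝ) (hPi' : ∀ i, Pi' i = ∫ a in A i, υ a ∂ν)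
    (hPipos : ∀ i, 0 < Pi' i) (hPile : ∀ i, Pi' i ≤ 1)
    (ε : ℝ) (hε : 0 < ε) (x : Fin J → ℝ) (hx : ∀ i, ε ≤ x i) (j : Fin J) :
    ∫ a in ⋃ i, A i,
        υ a ^ 2 * ((Pi' j)⁻¹ * (υ a * (A j).indicator (fun _ => (1 : ℝ)) a)) /
          (∑ i, x i * ((Pi' i)⁻¹ * (υ a * (A i).indicator (fun _ => (1 : ℝ)) a))) ^ 2 ∂ν ≤
      (∫ a in ⋃ i, A i, υ a ∂ν) / ε ^ 2 := by
  have hint : Integrable υ ν := by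
    by_contra h
    simp [integral_undef h] at hυ1
  have hcomp : ∀ i a, 0 ≤ (Pi' i)⁻¹ * (υ a * (A i).indicator (fun _ => (1 : ℝ)) a) := fun i a =>
    mul_nonneg (inv_nonneg.2 (hPipos i).le)
      (mul_nonneg (hυ0 a) (Set.indicator_nonneg (fun _ _ => zero_le_one) a))
  rw [← integral_div]
  refine integral_mono_of_nonneg (.of_forall fun a => ?_) (hint.integrableOn.div_const _)
    (.of_forall fun a => ?_)
  · exact div_nonneg (mul_nonneg (sq_nonneg _) (hcomp j a)) (sq_nonneg _)
  · have hsum : ε * ((Pi' j)⁻¹ * (υ a * (A j).indicator (fun _ => (1 : ℝ)) a)) ≤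
        ∑ i, x i * ((Pi' i)⁻¹ * (υ a * (A i).indicator (fun _ => (1 : ℝ)) a)) :=
      (mul_le_mul_of_nonneg_right (hx j) (hcomp j a)).trans
        (Finset.single_le_sum
          (f := fun i => x i * ((Pi' i)⁻¹ * (υ a * (A i).indicator (fun _ => (1 : ℝ)) a)))
          (fun i _ => mul_nonneg (hε.le.trans (hx i)) (hcomp i a)) (Finset.mem_univ j))
    by_cases ha : a ∈ A j
    · have hj : υ a * (A j).indicator (fun _ => (1 : ℝ)) a = υ a := by simp [ha]
      rw [hj] at hsum
      simpa only [hj] using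
        sq_mul_inv_mul_div_sq_le (hυ0 a) (hPipos j) (hPile j) hε hsum
    · have hj : υ a * (A j).indicator (fun _ => (1 : ℝ)) a = 0 := by simp [ha]
      simp only [hj, mul_zero, zero_div]
      exact div_nonneg (hυ0 a) (sq_nonneg _)
end
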